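/- Let H > 300 and let x = (x₁,x₂), y = (y₁,y₂) ∈ ℝ² satisfy x₂ ≥ H/100 and |x−y| < 3. Then log|x−ȳ| ≤ log(2x₂) + 300/H, where ȳ = (y₁,−y₂). -/

import Mathlib

open Real

noncomputable section

/-- The plane `ℝ²` with Euclidean norm. -/
abbrev E2 : Type := EuclideanSpace ℝ (Fin 2)

/-- Construct a point of `ℝ²` from coordinates. -/
def pt (a b : ℝ) : E2 := (WithLp.equiv 2 (Fin 2 → ℝ)).symm ![a, b]

/-- The reflection `(x₁, x₂) ↦ (x₁, −x₂)`. -/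
def bar (y : E2) : E2 := pt (y 0) (-(y 1))

theorem bar_sub (x y : E2) : bar (x - y) = bar x - bar y := by
  ext i
  fin_cases i
  · simp [bar, pt]
  · simp [bar, pt]
    ring

theorem norm_bar (y : E2) : ‖bar y‖ = ‖y‖ := by
  simp [EuclideanSpace.norm_eq, bar, pt, Fin.sum_univ_two]

theorem norm_sub_bar_self (x : E2) : ‖x - bar x‖ = 2 * |x 1| := by
  have h : (x 1 + x 1) ^ 2 = (2 * x 1) ^ 2 := by ring
  simp [EuclideanSpace.norm_eq, bar, pt, Fin.sum_univ_two, h, Real.sqrt_sq_eq_abs, abs_mul]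

theorem norm_sub_bar_le (x y : E2) : ‖x - bar y‖ ≤ 2 * |x 1| + ‖x - y‖ :=
  calc ‖x - bar y‖ ≤ ‖x - bar x‖ + ‖bar x - bar y‖ := norm_sub_le_norm_sub_add_norm_sub _ _ _
    _ = 2 * |x 1| + ‖x - y‖ := by rw [norm_sub_bar_self, ← bar_sub, norm_bar]

theorem log_add_le_log_add_div {a b : ℝ} (ha : 0 < a) (hb : 0 ≤ b) :
    Real.log (a + b) ≤ Real.log a + b / a := by
  have h : a + b = a * (1 + b / a) := by field_simp
  have h1 : 0 < 1 + b / a := by positivity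
  rw [h, Real.log_mul ha.ne' h1.ne']
  linarith [Real.log_le_sub_one_of_pos h1]

/-- Large-height case of the key pointwise kernel estimate: if `H > 300`, `x₂ ≥ H/100` and
`|x−y| < 3`, then `log|x−ȳ| ≤ log(2x₂) + 300/H`. -/
theorem kernel_estimate_large_height (H : ℝ) (hH : 300 < H) (x y : E2)
    (hx2 : H / 100 ≤ x 1) (hxy : ‖x - y‖ < 3) :
    Real.log ‖x - bar y‖ ≤ Real.log (2 * x 1) + 300 / H := by
  have ha : 0 < 2 * x 1 := by linarith
  have hle : ‖x - bar y‖ ≤ 2 * x 1 + 3 := by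
    have h := norm_sub_bar_le x y
    rw [abs_of_pos (by linarith)] at h
    linarith
  have hdiv : 3 / (2 * x 1) ≤ 300 / H := by
    rw [div_le_div_iff₀ ha (by linarith)]
    linarith
  rcases (norm_nonneg (x - bar y)).eq_or_lt with h0 | hpos
  · rw [← h0, Real.log_zero]
    have h1 : 0 ≤ Real.log (2 * x 1) := Real.log_nonneg (by linarith)
    positivity
  · calc Real.log ‖x - bar y‖ ≤ Real.log (2 * x 1 + 3) := Real.log_le_log hpos hle
      _ ≤ Real.log (2 * x 1) + 3 / (2 * x 1) := log_add_le_log_add_div ha (by norm_num)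
      _ ≤ Real.log (2 * x 1) + 300 / H := by gcongr

end
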